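/- Let L be a commutative C-loop and let K = {x ∈ L : x·x = e}. Then K is a normal subloop of L and the quotient loop L/K is a group (i.e., ((x·y)·z)·K = (x·(y·z))·K for all x, y, z ∈ L). -/

import Mathlib

/-- A loop: a set with a binary operation `*` and a two-sided identity `1` such that
all left and right translations are bijective (equivalently, the equations `a * x = b`
and `y * a = b` have unique solutions). -/
class Loop (L : Type*) extends Mul L, One L where
  one_mul : ∀ a : L, 1 * a = a
  mul_one : ∀ a : L, a * 1 = a
  mulLeft_bijective : ∀ a : L, Function.Bijective fun b => a * b
  mulRight_bijective : ∀ a : L, Function.Bijective fun b => b * a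

/-- A subloop of a loop: a subset containing `1`, closed under multiplication, and
closed under both divisions (solutions of `x * z = y` and `z * x = y` with `x, y ∈ S`
lie in `S`). -/
def IsSubloop {L : Type*} [Loop L] (S : Set L) : Prop :=
  (1 : L) ∈ S ∧ (∀ x ∈ S, ∀ y ∈ S, x * y ∈ S) ∧
  (∀ x ∈ S, ∀ y ∈ S, ∀ z : L, x * z = y → z ∈ S) ∧
  (∀ x ∈ S, ∀ y ∈ S, ∀ z : L, z * x = y → z ∈ S)

/-- The subloop generated by a subset: the intersection of all subloops containing it. -/
def subloopClosure {L : Type*} [Loop L] (T : Set L) : Set L :=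
  ⋂₀ {S : Set L | IsSubloop S ∧ T ⊆ S}

/-- A normal subloop: a subloop `S` with `x·S = S·x`, `x·(y·S) = (x·y)·S` and
`x·(S·y) = (x·S)·y` for all `x, y`. -/
def IsNormalSubloop {L : Type*} [Loop L] (S : Set L) : Prop :=
  IsSubloop S ∧ ∀ x y : L,
    ((fun n => x * n) '' S = (fun n => n * x) '' S) ∧
    ((fun n => x * (y * n)) '' S = (fun n => (x * y) * n) '' S) ∧
    ((fun n => x * (n * y)) '' S = (fun n => (x * n) * y) '' S)

/-- If the fibre condition `g (f n) = c` cuts out `S` and `f` is surjective, then `f '' S` is the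
fibre of `g` over `c`. -/
theorem Set.image_eq_fibre {L : Type*} {S : Set L} {f g : L → L} {c : L}
    (hf : Function.Surjective f)
    (h : ∀ n, n ∈ S ↔ g (f n) = c) : f '' S = {w | g w = c} := by
  ext w
  constructor
  · rintro ⟨n, hn, rfl⟩
    exact (h n).1 hn
  · intro hw
    obtain ⟨n, rfl⟩ := hf w
    exact ⟨n, (h n).2 hw, rfl⟩

namespace Loop

variable {L : Type*} [Loop L]

theorem mul_left_cancel' {a b c : L} (h : a * b = a * c) : b = c :=
  (mulLeft_bijective a).1 h

theorem exists_mul_left_eq (a b : L) : ∃ c, a * c = b :=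
  (mulLeft_bijective a).2 b

/-- In a C-loop, translation by a left inverse undoes left translation. -/
theorem inv_mul_cancel_left_of_C
    (hC : ∀ x y z : L, x * (y * (y * z)) = ((x * y) * y) * z)
    {x y : L} (hxy : x * y = 1) (w : L) : x * (y * w) = w := by
  obtain ⟨z, rfl⟩ := exists_mul_left_eq y w
  rw [hC, hxy, one_mul]

theorem mul_self_mul_of_C
    (hC : ∀ x y z : L, x * (y * (y * z)) = ((x * y) * y) * z)
    (x y : L) : (x * x) * y = x * (x * y) := by
  have h := hC 1 x y
  rw [one_mul, one_mul] at h
  exact h.symm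

theorem mul_mul_self_of_C
    (hC : ∀ x y z : L, x * (y * (y * z)) = ((x * y) * y) * z)
    (x y : L) : x * (y * y) = (x * y) * y := by
  simpa only [mul_one] using hC x y 1

/-- Squares lie in the middle nucleus. -/
theorem mul_self_middle_assoc
    (hC : ∀ x y z : L, x * (y * (y * z)) = ((x * y) * y) * z)
    (x y z : L) : (x * (y * y)) * z = x * ((y * y) * z) := by
  rw [mul_self_mul_of_C hC, hC, mul_mul_self_of_C hC]

/-- Squares lie in the left nucleus. -/
theorem mul_self_left_assoc
    (hC : ∀ x y z : L, x * (y * (y * z)) = ((x * y) * y) * z)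
    (hcomm : ∀ x y : L, x * y = y * x)
    (x y z : L) : ((x * x) * y) * z = (x * x) * (y * z) := by
  obtain ⟨a, ha⟩ := exists_mul_left_eq x 1
  obtain ⟨b, hb⟩ := exists_mul_left_eq y 1
  have hn : (a * a) * (x * x) = 1 := by
    rw [mul_self_mul_of_C hC, inv_mul_cancel_left_of_C hC ((hcomm a x).trans ha), hcomm, ha]
  have hba : (b * (a * a)) * ((x * x) * y) = 1 := by
    rw [mul_self_middle_assoc hC, inv_mul_cancel_left_of_C hC hn, hcomm, hb]
  apply mul_left_cancel' (a := b * (a * a))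
  rw [inv_mul_cancel_left_of_C hC hba, mul_self_middle_assoc hC,
    inv_mul_cancel_left_of_C hC hn, inv_mul_cancel_left_of_C hC ((hcomm b y).trans hb)]

/-- Squaring is an endomorphism of a commutative C-loop. -/
theorem mul_mul_mul_self
    (hC : ∀ x y z : L, x * (y * (y * z)) = ((x * y) * y) * z)
    (hcomm : ∀ x y : L, x * y = y * x)
    (x y : L) : (x * y) * (x * y) = (x * x) * (y * y) := by
  apply mul_left_cancel' (a := x)
  rw [mul_mul_self_of_C hC x (x * y), ← mul_self_mul_of_C hC, mul_self_left_assoc hC hcomm,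
    hcomm y (x * y), ← mul_mul_self_of_C hC, mul_self_mul_of_C hC x (x * (y * y)),
    mul_self_mul_of_C hC x (y * y)]

end Loop

/-- In a commutative C-loop, the set `K` of square roots of unity is a normal
subloop, and the quotient `L/K` is a group (associativity holds modulo `K`). -/
theorem statement16 {L : Type*} [Loop L]
    (hC : ∀ x y z : L, x * (y * (y * z)) = ((x * y) * y) * z)
    (hcomm : ∀ x y : L, x * y = y * x) :
    IsNormalSubloop {x : L | x * x = 1} ∧
    ∀ x y z : L,
      (fun k => ((x * y) * z) * k) '' {x : L | x * x = 1} =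
        (fun k => (x * (y * z)) * k) '' {x : L | x * x = 1} := by
  have hsq := Loop.mul_mul_mul_self hC hcomm
  have hassoc := Loop.mul_self_left_assoc hC hcomm
  have hsurj (a : L) : Function.Surjective fun n => a * n := (Loop.mulLeft_bijective a).2
  have hsurj' (a : L) : Function.Surjective fun n => n * a := (Loop.mulRight_bijective a).2
  have hcancel {a b : L} : b = 1 ↔ a * b = a :=
    ⟨fun h => by rw [h, Loop.mul_one],
      fun h => Loop.mul_left_cancel' (h.trans (Loop.mul_one a).symm)⟩
  have hcoset (a : L) : (fun k => a * k) '' {x : L | x * x = 1} = {w | w * w = a * a} :=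
    Set.image_eq_fibre (g := fun w => w * w) (hsurj a) fun n => by
      simp only [Set.mem_ofPred_eq, hsq]
      exact hcancel
  refine ⟨⟨⟨Loop.one_mul 1, ?_, ?_, ?_⟩, fun x y => ⟨?_, ?_, ?_⟩⟩, fun x y z => ?_⟩
  · intro x hx y hy
    simp only [Set.mem_ofPred_eq] at hx hy ⊢
    rw [hsq, hx, hy, Loop.one_mul]
  · rintro x hx _ hy z rfl
    simp only [Set.mem_ofPred_eq] at hx hy ⊢
    rwa [hsq, hx, Loop.one_mul] at hy
  · rintro x hx _ hy z rfl
    simp only [Set.mem_ofPred_eq] at hx hy ⊢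
    rwa [hsq, hx, Loop.mul_one] at hy
  · simp only [hcomm x]
  · rw [hcoset]
    refine Set.image_eq_fibre (g := fun w => w * w) ((hsurj x).comp (hsurj y)) fun n => ?_
    change n * n = 1 ↔ (x * (y * n)) * (x * (y * n)) = (x * y) * (x * y)
    rw [hsq x, hsq y, hsq x y, ← hassoc x]
    exact hcancel
  · have hfibre : (fun n => x * (n * y)) '' {x : L | x * x = 1} =
        {w | w * w = (x * y) * (x * y)} := by
      refine Set.image_eq_fibre (g := fun w => w * w) ((hsurj x).comp (hsurj' y)) fun n => ?_
      change n * n = 1 ↔ (x * (n * y)) * (x * (n * y)) = (x * y) * (x * y)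
      rw [hcomm n y, hsq x, hsq y, hsq x y, ← hassoc x]
      exact hcancel
    rw [hfibre]
    refine (Set.image_eq_fibre (g := fun w => w * w) ((hsurj' y).comp (hsurj x)) fun n => ?_).symm
    change n * n = 1 ↔ ((x * n) * y) * ((x * n) * y) = (x * y) * (x * y)
    rw [hsq (x * n), hsq x n, hsq x y, hassoc x, hcomm (n * n), ← hassoc x]
    exact hcancel
  · rw [hcoset, hcoset, hsq (x * y) z, hsq x y, hsq x (y * z), hsq y z, hassoc x]
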